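/- Let k ≥ 0 be an integer. Let M be the symmetric 5×5 integer matrix, with rows and columns indexed by {E, F, A, G, D_0}, given by: row E = (−(12k²+21k+10), k, k, 1, 1), row F = (k, −(12k²+21k+10), k, 1, 1), row A = (k, k, −1, 1, 1), row G = (1, 1, 1, −2, 0), row D_0 = (1, 1, 1, 0, −3). Then the cokernel ℤ^5 / M(ℤ^5) is isomorphic, as an abelian group, to ℤ × (ℤ/(k+1)(6k+5)ℤ). -/

import Mathlib

open Matrix

/-- The intersection matrix of the special fiber of the minimal regular model with
normal crossings of `X_s(p)` for `p = 12k+11`, in the basis `{E, F, A, G, D_0}`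
(where `G = D_{-1}`). -/
def xsMat11 (k : ℕ) : Matrix (Fin 5) (Fin 5) ℤ :=
  !![-(12 * (k : ℤ) ^ 2 + 21 * (k : ℤ) + 10), (k : ℤ), (k : ℤ), 1, 1;
     (k : ℤ), -(12 * (k : ℤ) ^ 2 + 21 * (k : ℤ) + 10), (k : ℤ), 1, 1;
     (k : ℤ), (k : ℤ), -1, 1, 1;
     1, 1, 1, -2, 0;
     1, 1, 1, 0, -3]

/-- The homomorphism `ℤ^5 → ℤ × ℤ/(k+1)(6k+5)` whose first component is the pairing with the
multiplicities of the special fiber, and whose kernel is the image of `xsMat11 k`. -/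
def xsCokerMap (k : ℕ) : (Fin 5 → ℤ) →ₗ[ℤ] ℤ × ZMod ((k + 1) * (6 * k + 5)) :=
  AddMonoidHom.toIntLinearMap <| AddMonoidHom.mk'
    (fun v => (v 0 + v 1 + (12 * k + 10) * v 2 + (6 * k + 6) * v 3 + (4 * k + 4) * v 4,
      ((v 1 + (6 * k + 5) * v 2 + 3 * (k + 1) * v 3 + 2 * (k + 1) * v 4 : ℤ) : ZMod _)))
    (fun v w => by
      ext
      · simp only [Pi.add_apply, Prod.fst_add]; ring
      · simp only [Pi.add_apply, Prod.snd_add]; push_cast; ring)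

theorem xsCokerMap_apply (k : ℕ) (v : Fin 5 → ℤ) :
    xsCokerMap k v =
      (v 0 + v 1 + (12 * k + 10) * v 2 + (6 * k + 6) * v 3 + (4 * k + 4) * v 4,
      ((v 1 + (6 * k + 5) * v 2 + 3 * (k + 1) * v 3 + 2 * (k + 1) * v 4 : ℤ) : ZMod _)) :=
  rfl

theorem xsCokerMap_surjective (k : ℕ) : Function.Surjective (xsCokerMap k) := by
  rintro ⟨x, y⟩
  obtain ⟨y, rfl⟩ := ZMod.intCast_surjective y
  exact ⟨![x - y, y, 0, 0, 0], by simp [xsCokerMap_apply]⟩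

theorem mem_ker_xsCokerMap_iff (k : ℕ) (v : Fin 5 → ℤ) :
    v ∈ LinearMap.ker (xsCokerMap k) ↔
      v 0 + v 1 + (12 * k + 10) * v 2 + (6 * k + 6) * v 3 + (4 * k + 4) * v 4 = 0 ∧
      ((k + 1) * (6 * k + 5) : ℤ) ∣
        v 1 + (6 * k + 5) * v 2 + 3 * (k + 1) * v 3 + 2 * (k + 1) * v 4 := by
  rw [LinearMap.mem_ker, xsCokerMap_apply, Prod.mk_eq_zero, ZMod.intCast_zmod_eq_zero_iff_dvd]
  push_cast
  rfl

theorem xsMat11_mulVec (k : ℕ) (w : Fin 5 → ℤ) :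
    xsMat11 k *ᵥ w =
      ![-(12 * (k : ℤ) ^ 2 + 21 * k + 10) * w 0 + k * w 1 + k * w 2 + w 3 + w 4,
        k * w 0 - (12 * (k : ℤ) ^ 2 + 21 * k + 10) * w 1 + k * w 2 + w 3 + w 4,
        k * w 0 + k * w 1 - w 2 + w 3 + w 4,
        w 0 + w 1 + w 2 - 2 * w 3,
        w 0 + w 1 + w 2 - 3 * w 4] := by
  ext i
  fin_cases i <;> simp [xsMat11, mulVec, dotProduct, Fin.sum_univ_five] <;> ring

theorem ker_xsCokerMap (k : ℕ) :
    LinearMap.ker (xsCokerMap k) = LinearMap.range (xsMat11 k).mulVecLin := by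
  ext v
  rw [mem_ker_xsCokerMap_iff, LinearMap.mem_range]
  simp only [mulVecLin_apply, xsMat11_mulVec]
  constructor
  · rintro ⟨h, c, hc⟩
    refine ⟨![c, 0, (6 * k + 5) * c - 6 * v 2 - 3 * v 3 - 2 * v 4,
      (3 * k + 3) * c - 3 * v 2 - 2 * v 3 - v 4, (2 * k + 2) * c - 2 * v 2 - v 3 - v 4], ?_⟩
    ext i
    fin_cases i <;> simp
    · linear_combination hc - h
    · linear_combination -hc
    all_goals ring
  · rintro ⟨w, rfl⟩
    simp only [cons_val]
    exact ⟨by ring, w 0 - w 1, by ring⟩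

/-- The cokernel `ℤ^5 / M(ℤ^5)` of the intersection matrix of the minimal regular model
with normal crossings of `X_s(p)`, `p = 12k+11`, is isomorphic as an abelian group to
`ℤ × ℤ/(k+1)(6k+5)`. -/
theorem cokernel_Xs_twelve_k_plus_eleven (k : ℕ) :
    Nonempty (((Fin 5 → ℤ) ⧸ LinearMap.range (Matrix.mulVecLin (xsMat11 k))) ≃+
      (ℤ × ZMod ((k + 1) * (6 * k + 5)))) := by
  rw [← ker_xsCokerMap]
  exact ⟨((xsCokerMap k).quotKerEquivOfSurjective (xsCokerMap_surjective k)).toAddEquiv⟩
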